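/- Let T be a bounded linear operator on a nontrivial complex Hilbert space H. Then w²(T) ≤ (1/2) ‖ T*T + TT* ‖ − (1/2) · inf_{‖x‖=1} ( ⟨|T|x, x⟩ − ⟨|T*|x, x⟩ )². -/

import Mathlib

open scoped InnerProductSpace NNReal

variable {H : Type*} [NormedAddCommGroup H] [InnerProductSpace ℂ H] [CompleteSpace H]

/-- The numerical radius `w(T) = sup { |⟨Tx, x⟩| : ‖x‖ = 1 }`. -/
noncomputable def numRadius (T : H →L[ℂ] H) : ℝ :=
  ⨆ x : {x : H // ‖x‖ = 1}, ‖⟪T x.1, x.1⟫_ℂ‖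

/-- The absolute value `|T| = (T*T)^(1/2)`. -/
noncomputable def opAbs (T : H →L[ℂ] H) : H →L[ℂ] H :=
  CFC.sqrt (star T * T)

/-- The real power `|T|^s` of the absolute value, via the continuous functional calculus. -/
noncomputable def opAbsPow (T : H →L[ℂ] H) (s : ℝ) : H →L[ℂ] H :=
  CFC.rpow (opAbs T) s

section Intertwining

variable {A : Type*} [CStarAlgebra A] [PartialOrder A] [StarOrderedRing A]

/-- A solution of the homogeneous Sylvester equation `q * x + x * p = 0` with `p` and `q`
nonnegative satisfies `x * p = 0`. -/
theorem mul_eq_zero_of_nonneg_of_mul_add_mul_eq_zero {p q x : A} (hp : 0 ≤ p) (hq : 0 ≤ q)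
    (h : q * x + x * p = 0) : x * p = 0 := by
  have hps : star p = p := (IsSelfAdjoint.of_nonneg hp).star_eq
  have hpos : 0 ≤ star x * q * x := star_left_conjugate_nonneg hq x
  have hxq : star x * x * p = -(star x * q * x) := by
    rw [mul_assoc, mul_assoc, eq_neg_of_add_eq_zero_left h, mul_neg, neg_neg]
  have hcomm : Commute (star x * x) p := by
    have hs := (IsSelfAdjoint.of_nonneg hpos).neg.star_eq
    rw [← hxq, star_mul, star_mul, star_star, hps] at hs
    exact hs.symm
  have hnonneg : 0 ≤ star x * x * p := hcomm.mul_nonneg (star_mul_self_nonneg x) hp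
  have hzero : star x * x * p = 0 :=
    le_antisymm (hxq ▸ neg_nonpos.mpr hpos) hnonneg
  rw [← CStarRing.star_mul_self_eq_zero_iff, star_mul, hps]
  calc p * star x * (x * p) = p * (star x * x * p) := by simp only [mul_assoc]
    _ = 0 := by rw [hzero, mul_zero]

/-- The absolute values of `t` and `star t` are intertwined by `t`. -/
theorem mul_sqrt_star_mul_self (t : A) :
    t * CFC.sqrt (star t * t) = CFC.sqrt (t * star t) * t := by
  set p := CFC.sqrt (star t * t)
  set q := CFC.sqrt (t * star t)
  have hp : 0 ≤ p := CFC.sqrt_nonneg _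
  have hq : 0 ≤ q := CFC.sqrt_nonneg _
  have hps : star p = p := (IsSelfAdjoint.of_nonneg hp).star_eq
  have hqs : star q = q := (IsSelfAdjoint.of_nonneg hq).star_eq
  have hpp : p * p = star t * t := CFC.sqrt_mul_sqrt_self _ (star_mul_self_nonneg t)
  have hqq : q * q = t * star t := CFC.sqrt_mul_sqrt_self _ (mul_star_self_nonneg t)
  set x := t * p - q * t with hx
  have hsyl : q * x + x * p = 0 := by
    have h1 : q * x + x * p = t * (p * p) - q * q * t := by rw [hx]; noncomm_ring
    rw [h1, hpp, hqq]; noncomm_ring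
  have hxp : x * p = 0 := mul_eq_zero_of_nonneg_of_mul_add_mul_eq_zero hp hq hsyl
  have hqx : q * x = 0 := by simpa [hxp] using hsyl
  have hxq : star x * q = 0 := by simpa [hqs] using congrArg star hqx
  have hpx : p * star x = 0 := by simpa [hps] using congrArg star hxp
  have hxx : star x * x = star x * t * p := by
    calc star x * x = star x * t * p - star x * q * t := by
          conv_lhs => rw [hx, mul_sub, ← mul_assoc, ← mul_assoc, ← hx]
      _ = star x * t * p := by rw [hxq, zero_mul, sub_zero]
  have hsq : star (star x * x) * (star x * x) = 0 := by
    rw [star_mul, star_star]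
    calc star x * x * (star x * x) = star x * t * (p * star x) * x := by
          conv_lhs => enter [1]; rw [hxx]
          simp only [mul_assoc]
      _ = 0 := by rw [hpx, mul_zero, zero_mul]
  have : x = 0 := by
    rwa [CStarRing.star_mul_self_eq_zero_iff, CStarRing.star_mul_self_eq_zero_iff] at hsq
  exact sub_eq_zero.mp this

end Intertwining

theorem opAbs_nonneg (T : H →L[ℂ] H) : 0 ≤ opAbs T := CFC.sqrt_nonneg _

theorem opAbs_mul_self (T : H →L[ℂ] H) : opAbs T * opAbs T = star T * T :=
  CFC.sqrt_mul_sqrt_self _ (star_mul_self_nonneg T)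

theorem mul_opAbs (T : H →L[ℂ] H) : T * opAbs T = opAbs (star T) * T := by
  simpa [opAbs] using mul_sqrt_star_mul_self T

theorem inner_apply_left_of_nonneg {P : H →L[ℂ] H} (hP : 0 ≤ P) (u v : H) :
    ⟪P u, v⟫_ℂ = ⟪u, P v⟫_ℂ := by
  rw [← ContinuousLinearMap.adjoint_inner_right, ← ContinuousLinearMap.star_eq_adjoint,
    (IsSelfAdjoint.of_nonneg hP).star_eq]

/-- The Cauchy–Schwarz inequality for the semi-inner product of a nonnegative operator. -/
theorem norm_inner_apply_sq_le_of_nonneg {P : H →L[ℂ] H} (hP : 0 ≤ P) (u v : H) :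
    ‖⟪P u, v⟫_ℂ‖ ^ 2 ≤ (⟪P u, u⟫_ℂ).re * (⟪P v, v⟫_ℂ).re := by
  have key (a b : H) : ⟪P a, b⟫_ℂ = ⟪CFC.sqrt P a, CFC.sqrt P b⟫_ℂ := by
    rw [← inner_apply_left_of_nonneg (CFC.sqrt_nonneg P), ← mul_apply_eq_comp,
      CFC.sqrt_mul_sqrt_self P hP]
  rw [key u v, key u u, key v v]
  have h := inner_mul_inner_self_le (𝕜 := ℂ) (CFC.sqrt P u) (CFC.sqrt P v)
  rwa [norm_inner_symm (CFC.sqrt P v), ← sq] at h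

/-- The mixed Cauchy–Schwarz inequality for vectors in the range of `|T*|`. -/
theorem norm_inner_apply_opAbs_sq_le (T : H →L[ℂ] H) (x z : H) :
    ‖⟪T x, opAbs (star T) z⟫_ℂ‖ ^ 2 ≤ (⟪opAbs T x, x⟫_ℂ).re *
      (⟪opAbs (star T) (opAbs (star T) z), opAbs (star T) z⟫_ℂ).re := by
  have hQ := opAbs_nonneg (star T)
  have adj (a b : H) : ⟪T a, b⟫_ℂ = ⟪a, star T b⟫_ℂ := by
    rw [ContinuousLinearMap.star_eq_adjoint, ContinuousLinearMap.adjoint_inner_right]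
  have comm (a : H) : opAbs (star T) (T a) = T (opAbs T a) :=
    (DFunLike.congr_fun (mul_opAbs T) a).symm
  have sq' (a : H) : opAbs (star T) (opAbs (star T) a) = T (star T a) := by
    simpa using DFunLike.congr_fun (opAbs_mul_self (star T)) a
  have h1 : ⟪T x, opAbs (star T) z⟫_ℂ = ⟪opAbs T x, star T z⟫_ℂ := by
    rw [← inner_apply_left_of_nonneg hQ, comm, adj]
  have h2 : ⟪opAbs (star T) (opAbs (star T) z), opAbs (star T) z⟫_ℂ
      = ⟪opAbs T (star T z), star T z⟫_ℂ := by
    rw [sq' z, ← inner_apply_left_of_nonneg hQ, comm, adj]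
  rw [h1, h2]
  exact norm_inner_apply_sq_le_of_nonneg (opAbs_nonneg T) x (star T z)

/-- The mixed Cauchy–Schwarz inequality `|⟨Tx, y⟩|² ≤ ⟨|T|x, x⟩ ⟨|T*|y, y⟩`. -/
theorem norm_inner_apply_sq_le_opAbs (T : H →L[ℂ] H) (x y : H) :
    ‖⟪T x, y⟫_ℂ‖ ^ 2 ≤ (⟪opAbs T x, x⟫_ℂ).re * (⟪opAbs (star T) y, y⟫_ℂ).re := by
  set Q := opAbs (star T)
  have hQ : 0 ≤ Q := opAbs_nonneg (star T)
  have hker (k : H) (hk : k ∈ Q.rangeᗮ) : Q k = 0 ∧ ⟪T x, k⟫_ℂ = 0 := by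
    have hQk : Q k = 0 := by
      rw [← inner_self_eq_zero (𝕜 := ℂ), inner_apply_left_of_nonneg hQ]
      exact Submodule.inner_left_of_mem_orthogonal (LinearMap.mem_range_self _ (Q k)) hk
    have hTT : T (star T k) = 0 := by
      have h : Q (Q k) = T (star T k) := by
        simpa using DFunLike.congr_fun (opAbs_mul_self (star T)) k
      rw [← h, hQk, map_zero]
    have hTk : star T k = 0 := by
      rw [← inner_self_eq_zero (𝕜 := ℂ)]
      nth_rw 1 [ContinuousLinearMap.star_eq_adjoint]
      rw [ContinuousLinearMap.adjoint_inner_left, hTT, inner_zero_right]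
    refine ⟨hQk, ?_⟩
    rw [← ContinuousLinearMap.adjoint_inner_right, ← ContinuousLinearMap.star_eq_adjoint, hTk,
      inner_zero_right]
  have hclosure (u : H) (hu : u ∈ Q.range.topologicalClosure) :
      ‖⟪T x, u⟫_ℂ‖ ^ 2 ≤ (⟪opAbs T x, x⟫_ℂ).re * (⟪Q u, u⟫_ℂ).re := by
    refine closure_minimal (s := (Q.range : Set H)) (t := {u | ‖⟪T x, u⟫_ℂ‖ ^ 2 ≤
      (⟪opAbs T x, x⟫_ℂ).re * (⟪Q u, u⟫_ℂ).re}) ?_ ?_ hu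
    · rintro _ ⟨z, rfl⟩
      exact norm_inner_apply_opAbs_sq_le T x z
    · refine isClosed_le (by fun_prop) ?_
      exact continuous_const.mul
        (Complex.continuous_re.comp (Q.continuous.inner continuous_id))
  obtain ⟨u, hu, k, hk, rfl⟩ :=
    Q.range.topologicalClosure.exists_add_mem_mem_orthogonal y
  rw [Submodule.orthogonal_closure] at hk
  obtain ⟨hQk, hTk⟩ := hker k hk
  have hQu : ⟪Q u, k⟫_ℂ = 0 := by
    rw [inner_apply_left_of_nonneg hQ, hQk, inner_zero_right]
  simpa [inner_add_right, hQk, hTk, hQu] using hclosure u hu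

theorem re_inner_opAbs_sq_le (T : H →L[ℂ] H) {x : H} (hx : ‖x‖ = 1) :
    (⟪opAbs T x, x⟫_ℂ).re ^ 2 ≤ (⟪(star T * T) x, x⟫_ℂ).re := by
  have h : (⟪(star T * T) x, x⟫_ℂ).re = ‖opAbs T x‖ ^ 2 := by
    rw [← opAbs_mul_self, mul_apply_eq_comp,
      inner_apply_left_of_nonneg (opAbs_nonneg T)]
    exact inner_self_eq_norm_sq (𝕜 := ℂ) _
  rw [h, sq_le_sq, abs_norm]
  calc |(⟪opAbs T x, x⟫_ℂ).re| ≤ ‖⟪opAbs T x, x⟫_ℂ‖ := Complex.abs_re_le_norm _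
    _ ≤ ‖opAbs T x‖ * ‖x‖ := norm_inner_le_norm _ _
    _ = ‖opAbs T x‖ := by rw [hx, mul_one]

theorem norm_inner_apply_self_sq_le (T : H →L[ℂ] H) {x : H} (hx : ‖x‖ = 1) :
    ‖⟪T x, x⟫_ℂ‖ ^ 2 ≤ (1 / 2 : ℝ) * ‖star T * T + T * star T‖ -
      (1 / 2 : ℝ) * ((⟪opAbs T x, x⟫_ℂ).re - (⟪opAbs (star T) x, x⟫_ℂ).re) ^ 2 := by
  have h1 := norm_inner_apply_sq_le_opAbs T x x
  have h2 := re_inner_opAbs_sq_le T hx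
  have h3 := re_inner_opAbs_sq_le (star T) hx
  rw [star_star] at h3
  have h4 : (⟪(star T * T) x, x⟫_ℂ).re + (⟪(T * star T) x, x⟫_ℂ).re
      ≤ ‖star T * T + T * star T‖ := by
    calc _ = (⟪(star T * T + T * star T) x, x⟫_ℂ).re := by
          rw [add_apply, inner_add_left, Complex.add_re]
      _ ≤ ‖⟪(star T * T + T * star T) x, x⟫_ℂ‖ := Complex.re_le_norm _
      _ ≤ ‖(star T * T + T * star T) x‖ * ‖x‖ := norm_inner_le_norm _ _
      _ ≤ ‖star T * T + T * star T‖ := by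
          simpa [hx] using (star T * T + T * star T).le_opNorm x
  linarith [sub_sq (⟪opAbs T x, x⟫_ℂ).re (⟪opAbs (star T) x, x⟫_ℂ).re]

theorem stmt13 [Nontrivial H] (T : H →L[ℂ] H) :
    numRadius T ^ 2 ≤
      (1 / 2 : ℝ) * ‖star T * T + T * star T‖ -
        (1 / 2 : ℝ) *
          ⨅ x : {x : H // ‖x‖ = 1},
            ((⟪(opAbs T) x.1, x.1⟫_ℂ).re - (⟪(opAbs (star T)) x.1, x.1⟫_ℂ).re) ^ 2 := by
  have hle (x : {x : H // ‖x‖ = 1}) : ‖⟪T x.1, x.1⟫_ℂ‖ ^ 2 ≤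
      (1 / 2 : ℝ) * ‖star T * T + T * star T‖ - (1 / 2 : ℝ) * ⨅ x : {x : H // ‖x‖ = 1},
        ((⟪(opAbs T) x.1, x.1⟫_ℂ).re - (⟪(opAbs (star T)) x.1, x.1⟫_ℂ).re) ^ 2 := by
    refine (norm_inner_apply_self_sq_le T x.2).trans ?_
    gcongr
    exact ciInf_le (f := fun x : {x : H // ‖x‖ = 1} =>
      ((⟪(opAbs T) x.1, x.1⟫_ℂ).re - (⟪(opAbs (star T)) x.1, x.1⟫_ℂ).re) ^ 2)
      ⟨0, by rintro _ ⟨y, rfl⟩; positivity⟩ x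
  obtain ⟨x₀, hx₀⟩ := exists_norm_eq H zero_le_one
  have : Nonempty {x : H // ‖x‖ = 1} := ⟨⟨x₀, hx₀⟩⟩
  refine (Real.le_sqrt (Real.iSup_nonneg fun _ => norm_nonneg _)
    ((sq_nonneg _).trans (hle ⟨x₀, hx₀⟩))).mp ?_
  exact ciSup_le fun x => Real.le_sqrt_of_sq_le (hle x)
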